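/- arXiv:2003.05711 — 2 statements merged into one kernel-verified Lean document; each statement's English description precedes it below -/
import Mathlib

section
/- Let n ∈ ℕ*, A, C ∈ ℂ^{n×n}, r > 0, ε ∈ (0,r), and σ > 0. There exist constants γ₀, γ₁ > 0, depending only on A, C, r, ε, σ, such that for any continuous d : [0,∞) → [−1,1], continuous q : [0,∞) → ℂ with |q| ≤ 1, continuous p : [0,∞) → ℂ^n, x₀ ∈ C([−r−ε,0];ℂ^n), and any solution x of the delay ODE associated with (d,q,p,x₀): sup_{τ∈[0,2ε]} ‖x(τ)‖ ≤ γ₀ sup_{τ∈[−r−ε,0]} ‖x₀(τ)‖ + γ₁ sup_{τ∈[0,2ε]} e^{στ}‖p(τ)‖. -/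
open Set

open scoped Topology

/-- A solution of the delay ODE
`ẋ(t) = A x(t) + q(t) C (x(t−r−ε d(t)) − x(t−r)) + p(t)` for `t > 0`,
with history `x₀` on `[−r−ε, 0]`. -/
def IsDelaySol {n : ℕ} (A C : EuclideanSpace ℂ (Fin n) →L[ℂ] EuclideanSpace ℂ (Fin n))
    (r ε : ℝ) (d : ℝ → ℝ) (q : ℝ → ℂ) (p : ℝ → EuclideanSpace ℂ (Fin n))
    (x₀ x : ℝ → EuclideanSpace ℂ (Fin n)) : Prop :=
  ContinuousOn x (Set.Ici (-(r + ε))) ∧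
  (∀ t ∈ Set.Icc (-(r + ε)) (0 : ℝ), x t = x₀ t) ∧
  ∀ t > (0 : ℝ),
    HasDerivAt x (A (x t) + q t • (C (x (t - r - ε * d t) - x (t - r))) + p t) t

theorem Real.le_biSup_Icc_of_continuousOn {f : ℝ → ℝ} {a b t : ℝ}
    (hf : ContinuousOn f (Icc a b)) (ht : t ∈ Icc a b) :
    f t ≤ ⨆ s ∈ Icc a b, f s := by
  obtain ⟨M, hM⟩ := isCompact_Icc.bddAbove_image hf
  have hbdd : BddAbove (range fun s ↦ ⨆ _ : s ∈ Icc a b, f s) := by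
    refine ⟨max M 0, ?_⟩
    rintro _ ⟨s, rfl⟩
    exact Real.iSup_le (fun hs ↦ (hM (mem_image_of_mem f hs)).trans (le_max_left _ _))
      (le_max_right _ _)
  refine le_trans ?_ (le_ciSup hbdd t)
  simp [ht]

/-- If `‖f‖` stays below `B` to the left of `t` and touches it at `t`, then `B` grows at most as
fast as `f` moves at `t`. -/
theorem HasDerivAt.le_norm_of_norm_le_left {E : Type*} [NormedAddCommGroup E] [NormedSpace ℝ E]
    {f : ℝ → E} {f' : E} {B : ℝ → ℝ} {B' t : ℝ} (hf : HasDerivAt f f' t)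
    (hB : HasDerivAt B B' t) (heq : ‖f t‖ = B t)
    (hle : ∀ᶠ s in 𝓝[<] t, ‖f s‖ ≤ B s) : B' ≤ ‖f'‖ := by
  have hsub : 𝓝[<] t ≤ 𝓝[≠] t := nhdsWithin_mono _ fun s hs ↦ ne_of_lt hs
  refine le_of_tendsto_of_tendsto ((hasDerivAt_iff_tendsto_slope.1 hB).mono_left hsub)
    ((hasDerivAt_iff_tendsto_slope.1 hf).mono_left hsub).norm ?_
  filter_upwards [hle, self_mem_nhdsWithin] with s hs hst
  have hst' : 0 < t - s := sub_pos.2 hst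
  have key : B t - B s ≤ ‖f t - f s‖ := by
    linarith [norm_sub_norm_le (f t) (f s)]
  rw [slope_comm B, slope_comm f, slope_def_module, slope_def_module, norm_smul, norm_inv,
    Real.norm_of_nonneg hst'.le, smul_eq_mul]
  gcongr

theorem IsDelaySol.norm_le {n : ℕ}
    {A C : EuclideanSpace ℂ (Fin n) →L[ℂ] EuclideanSpace ℂ (Fin n)} {r ε T X P : ℝ}
    (hε : 0 ≤ ε) (hεr : ε ≤ r) {d : ℝ → ℝ} {q : ℝ → ℂ} {p x₀ x : ℝ → EuclideanSpace ℂ (Fin n)}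
    (hd : ∀ t ≥ (0 : ℝ), |d t| ≤ 1) (hq : ∀ t ≥ (0 : ℝ), ‖q t‖ ≤ 1)
    (hx : IsDelaySol A C r ε d q p x₀ x)
    (hX : ∀ t ∈ Icc (-(r + ε)) (0 : ℝ), ‖x₀ t‖ ≤ X) (hP : ∀ t ∈ Icc 0 T, ‖p t‖ ≤ P)
    {t : ℝ} (ht : t ∈ Icc 0 T) :
    ‖x t‖ ≤ Real.exp ((‖A‖ + 2 * ‖C‖ + 1) * T) * (X + P) := by
  obtain ⟨hcont, hinit, hderiv⟩ := hx
  set K := ‖A‖ + 2 * ‖C‖ + 1 with hK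
  have hK0 : 0 ≤ K := by positivity
  have hT : 0 ≤ T := ht.1.trans ht.2
  have hX0 : 0 ≤ X := (norm_nonneg _).trans (hX 0 ⟨by linarith, le_rfl⟩)
  have hP0 : 0 ≤ P := (norm_nonneg _).trans (hP 0 ⟨le_rfl, hT⟩)
  -- Compare with the point where the exponentially weighted norm is maximal.
  obtain ⟨u, hu, hmax⟩ := isCompact_Icc.exists_isMaxOn ⟨0, le_rfl, hT⟩
    (f := fun s ↦ Real.exp (-(K * s)) * ‖x s‖)
    (ContinuousOn.mul (by fun_prop)
      (hcont.mono fun s (hs : s ∈ Icc 0 T) ↦ by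
        simp only [mem_Ici]; linarith [hs.1]).norm)
  have hle : ∀ s ∈ Icc 0 T, ‖x s‖ ≤ Real.exp (K * (s - u)) * ‖x u‖ := by
    intro s hs
    have h := mul_le_mul_of_nonneg_left (hmax hs) (Real.exp_pos (K * s)).le
    rw [← mul_assoc, ← mul_assoc, ← Real.exp_add, ← Real.exp_add, add_neg_cancel,
      Real.exp_zero, one_mul, ← sub_eq_add_neg, ← mul_sub] at h
    exact h
  have hxu : ‖x u‖ ≤ X + P := by
    rcases hu.1.eq_or_lt with h0 | h0
    · rw [← h0, hinit 0 ⟨by linarith, le_rfl⟩]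
      linarith [hX 0 ⟨by linarith, le_rfl⟩]
    by_contra! hlt
    have hB : HasDerivAt (fun s ↦ Real.exp (K * (s - u)) * ‖x u‖) (K * ‖x u‖) u := by
      have h := (((hasDerivAt_id u).sub_const u).const_mul K).exp.mul_const ‖x u‖
      simpa using h
    have h1 := (hderiv u h0).le_norm_of_norm_le_left hB (by simp) (by
      filter_upwards [Ioo_mem_nhdsLT h0] with s hs
      exact hle s ⟨hs.1.le, hs.2.le.trans hu.2⟩)
    have hpast : ∀ s, -(r + ε) ≤ s → s ≤ u → ‖x s‖ ≤ ‖x u‖ := by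
      intro s hs hsu
      rcases le_total s 0 with hs0 | hs0
      · rw [hinit s ⟨hs, hs0⟩]
        linarith [hX s ⟨hs, hs0⟩]
      · refine (hle s ⟨hs0, hsu.trans hu.2⟩).trans (mul_le_of_le_one_left (norm_nonneg _) ?_)
        exact Real.exp_le_one_iff.2 (mul_nonpos_of_nonneg_of_nonpos hK0 (by linarith))
    have hdu := abs_le.1 (hd u h0.le)
    have hx1 := hpast (u - r - ε * d u) (by nlinarith) (by nlinarith)
    have hx2 := hpast (u - r) (by linarith) (by linarith)
    have hA := A.le_opNorm (x u)
    have hC : ‖q u • C (x (u - r - ε * d u) - x (u - r))‖ ≤ ‖C‖ * (2 * ‖x u‖) := by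
      rw [norm_smul]
      refine (mul_le_of_le_one_left (norm_nonneg _) (hq u h0.le)).trans
        ((C.le_opNorm _).trans ?_)
      gcongr
      linarith [norm_sub_le (x (u - r - ε * d u)) (x (u - r))]
    have h2 := h1.trans norm_add₃_le
    have hPu := hP u hu
    rw [hK] at h2
    linarith
  refine (hle t ht).trans ?_
  gcongr
  linarith [hu.1, ht.2]

theorem stmt3 {n : ℕ} (hn : 0 < n)
    (A C : EuclideanSpace ℂ (Fin n) →L[ℂ] EuclideanSpace ℂ (Fin n))
    (r : ℝ) (hr : 0 < r) (ε : ℝ) (hε : ε ∈ Set.Ioo 0 r) (σ : ℝ) (hσ : 0 < σ) :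
    ∃ γ₀ γ₁ : ℝ, 0 < γ₀ ∧ 0 < γ₁ ∧
      ∀ (d : ℝ → ℝ) (q : ℝ → ℂ) (p x₀ x : ℝ → EuclideanSpace ℂ (Fin n)),
        ContinuousOn d (Set.Ici 0) → (∀ t ≥ (0 : ℝ), |d t| ≤ 1) →
        ContinuousOn q (Set.Ici 0) → (∀ t ≥ (0 : ℝ), ‖q t‖ ≤ 1) →
        ContinuousOn p (Set.Ici 0) →
        ContinuousOn x₀ (Set.Icc (-(r + ε)) 0) →
        IsDelaySol A C r ε d q p x₀ x →
        (⨆ τ ∈ Set.Icc (0 : ℝ) (2 * ε), ‖x τ‖)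
          ≤ γ₀ * (⨆ τ ∈ Set.Icc (-(r + ε)) (0 : ℝ), ‖x₀ τ‖)
            + γ₁ * ⨆ τ ∈ Set.Icc (0 : ℝ) (2 * ε), Real.exp (σ * τ) * ‖p τ‖ := by
  have hT : (0 : ℝ) ≤ 2 * ε := by linarith [hε.1]
  refine ⟨Real.exp ((‖A‖ + 2 * ‖C‖ + 1) * (2 * ε)), Real.exp ((‖A‖ + 2 * ‖C‖ + 1) * (2 * ε)),
    Real.exp_pos _, Real.exp_pos _, fun d q p x₀ x _ hd _ hq hp hx₀ hx ↦ ?_⟩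
  have hX : ∀ t ∈ Icc (-(r + ε)) (0 : ℝ), ‖x₀ t‖ ≤ ⨆ τ ∈ Icc (-(r + ε)) (0 : ℝ), ‖x₀ τ‖ :=
    fun t ht ↦ Real.le_biSup_Icc_of_continuousOn hx₀.norm ht
  have hP : ∀ t ∈ Icc (0 : ℝ) (2 * ε),
      ‖p t‖ ≤ ⨆ τ ∈ Icc (0 : ℝ) (2 * ε), Real.exp (σ * τ) * ‖p τ‖ := by
    intro t ht
    refine le_trans ?_ (Real.le_biSup_Icc_of_continuousOn
      (f := fun τ ↦ Real.exp (σ * τ) * ‖p τ‖)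
      (ContinuousOn.mul (by fun_prop) (hp.mono Icc_subset_Ici_self).norm) ht)
    exact le_mul_of_one_le_left (norm_nonneg _) (Real.one_le_exp (mul_nonneg hσ.le ht.1))
  have key := fun t ht ↦ hx.norm_le (t := t) hε.1.le hε.2.le hd hq hX hP ht
  have h0 := (norm_nonneg _).trans (key 0 ⟨le_rfl, hT⟩)
  rw [← mul_add]
  exact Real.iSup_le (fun t ↦ Real.iSup_le (key t) h0) h0
end

section
/- Let a > κ > 0, D₀ > 0, δ ∈ (0,D₀), let D : [0,∞) → [D₀−δ, D₀+δ] be continuous, let m ∈ ℕ*, and let u : ℝ → ℂ^m be continuous with u(s) = 0 for all s ≤ 0. Then for all t ≥ 0: ∫_0^t e^{−a(t−τ)} ‖u(τ−D(τ))‖ dτ ≤ (e^{κ(D₀+δ)}/(a−κ)) · sup_{s∈[0,max(t−(D₀−δ),0)]} e^{−κ(t−s)} ‖u(s)‖. -/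
open Set

/-- For real-valued functions that are nonnegative and bounded above on `K`, the value at a point
of `K` is at most the iterated supremum. -/
theorem le_biSup_of_nonneg_of_bddAbove {α : Type*} {K : Set α} {f : α → ℝ}
    (hf : ∀ x ∈ K, 0 ≤ f x) (hb : BddAbove (f '' K)) {x : α} (hx : x ∈ K) :
    f x ≤ ⨆ y ∈ K, f y := by
  obtain ⟨C, hC⟩ := hb
  have hC' : ∀ y ∈ K, f y ≤ C := fun y hy => hC (mem_image_of_mem f hy)
  have hbdd : BddAbove (range fun y => ⨆ _ : y ∈ K, f y) := by
    refine ⟨C, ?_⟩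
    rintro _ ⟨y, rfl⟩
    exact Real.iSup_le (fun hy => hC' y hy) ((hf x hx).trans (hC' x hx))
  have h := le_ciSup hbdd x
  simpa only [ciSup_pos hx] using h

theorem integral_exp_neg_mul_sub {b : ℝ} (hb : b ≠ 0) (t : ℝ) :
    ∫ τ in (0 : ℝ)..t, Real.exp (-b * (t - τ)) = (1 - Real.exp (-b * t)) / b := by
  have hderiv : ∀ τ ∈ uIcc 0 t,
      HasDerivAt (fun τ => Real.exp (-b * (t - τ)) / b) (Real.exp (-b * (t - τ))) τ := by
    intro τ _
    have h := ((((hasDerivAt_id' τ).const_sub t).const_mul (-b)).exp).div_const b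
    rwa [mul_neg_one, neg_neg, mul_div_cancel_right₀ _ hb] at h
  rw [intervalIntegral.integral_eq_sub_of_hasDerivAt hderiv
    (Continuous.intervalIntegrable (by fun_prop) _ _)]
  simp [sub_div]

theorem stmt15 (a κ D₀ δ : ℝ) (hκ : 0 < κ) (hκa : κ < a) (hD₀ : 0 < D₀)
    (hδ : δ ∈ Set.Ioo 0 D₀) {m : ℕ} (hm : 0 < m)
    (D : ℝ → ℝ) (hD : ContinuousOn D (Set.Ici 0))
    (hDr : ∀ t ≥ (0 : ℝ), D t ∈ Set.Icc (D₀ - δ) (D₀ + δ))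
    (u : ℝ → EuclideanSpace ℂ (Fin m)) (hu : Continuous u)
    (hu0 : ∀ s ≤ (0 : ℝ), u s = 0) :
    ∀ t ≥ (0 : ℝ),
      (∫ τ in (0 : ℝ)..t, Real.exp (-a * (t - τ)) * ‖u (τ - D τ)‖)
        ≤ (Real.exp (κ * (D₀ + δ)) / (a - κ)) *
            ⨆ s ∈ Set.Icc 0 (max (t - (D₀ - δ)) 0), Real.exp (-κ * (t - s)) * ‖u s‖ := by
  intro t ht
  set M := ⨆ s ∈ Set.Icc 0 (max (t - (D₀ - δ)) 0), Real.exp (-κ * (t - s)) * ‖u s‖ with hM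
  have hM0 : 0 ≤ M := Real.iSup_nonneg fun s => Real.iSup_nonneg fun _ => by positivity
  have hle : ∀ s ∈ Set.Icc 0 (max (t - (D₀ - δ)) 0), Real.exp (-κ * (t - s)) * ‖u s‖ ≤ M := by
    intro s hs
    refine le_biSup_of_nonneg_of_bddAbove (f := fun s => Real.exp (-κ * (t - s)) * ‖u s‖)
      (fun _ _ => by positivity) ?_ hs
    exact (isCompact_Icc.image (by fun_prop)).bddAbove
  have hb : 0 < a - κ := sub_pos.2 hκa
  have hpt : ∀ τ ∈ Icc 0 t, Real.exp (-a * (t - τ)) * ‖u (τ - D τ)‖ ≤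
      Real.exp (κ * (D₀ + δ)) * M * Real.exp (-(a - κ) * (t - τ)) := by
    intro τ hτ
    obtain ⟨hD1, hD2⟩ := hDr τ hτ.1
    rcases le_or_gt (τ - D τ) 0 with hs | hs
    · rw [hu0 _ hs, norm_zero, mul_zero]
      positivity
    · have h := hle (τ - D τ) ⟨hs.le, le_max_of_le_left (by linarith [hτ.2])⟩
      calc Real.exp (-a * (t - τ)) * ‖u (τ - D τ)‖
          = Real.exp (κ * D τ) * Real.exp (-(a - κ) * (t - τ)) *
              (Real.exp (-κ * (t - (τ - D τ))) * ‖u (τ - D τ)‖) := by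
            rw [← mul_assoc, ← Real.exp_add, ← Real.exp_add]
            ring_nf
        _ ≤ Real.exp (κ * (D₀ + δ)) * Real.exp (-(a - κ) * (t - τ)) * M := by gcongr
        _ = _ := by ring
  have hcont : ContinuousOn (fun τ => Real.exp (-a * (t - τ)) * ‖u (τ - D τ)‖) (uIcc 0 t) := by
    have hD' : ContinuousOn D (uIcc 0 t) :=
      hD.mono (by rw [uIcc_of_le ht]; exact Icc_subset_Ici_self)
    exact ContinuousOn.mul (by fun_prop) (hu.comp_continuousOn (continuousOn_id.sub hD')).norm
  calc (∫ τ in (0 : ℝ)..t, Real.exp (-a * (t - τ)) * ‖u (τ - D τ)‖)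
      ≤ ∫ τ in (0 : ℝ)..t, Real.exp (κ * (D₀ + δ)) * M * Real.exp (-(a - κ) * (t - τ)) :=
        intervalIntegral.integral_mono_on ht hcont.intervalIntegrable
          (Continuous.intervalIntegrable (by fun_prop) _ _) hpt
    _ = Real.exp (κ * (D₀ + δ)) * M * ((1 - Real.exp (-(a - κ) * t)) / (a - κ)) := by
        rw [intervalIntegral.integral_const_mul, integral_exp_neg_mul_sub hb.ne']
    _ ≤ Real.exp (κ * (D₀ + δ)) * M * (1 / (a - κ)) := by
        gcongr
        linarith [Real.exp_pos (-(a - κ) * t)]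
    _ = _ := by ring
end
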